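/- Fix d ≥ 1 and real numbers s, r with 0 ≤ s ≤ r and 2r > d. Then there exists a constant C = C(d, s, r) such that for all functions a, b : ℤ^d → ℂ with ∑_{k ∈ ℤ^d} (1+|k|₂²)^r |a_k|² < ∞ and ∑_{k ∈ ℤ^d} (1+|k|₂²)^s |b_k|² < ∞, the convolution a*b (defined by (a*b)_k := ∑_{ℓ ∈ ℤ^d} a_ℓ b_{k−ℓ}, which converges absolutely for every k) satisfies ∑_{k ∈ ℤ^d} (1+|k|₂²)^s |(a*b)_k|² ≤ C · (∑_{k ∈ ℤ^d} (1+|k|₂²)^r |a_k|²) · (∑_{k ∈ ℤ^d} (1+|k|₂²)^s |b_k|²). (This is the Sobolev multiplication inequality ‖Vψ‖_{H^s} ≤ C ‖V‖_{H^r} ‖ψ‖_{H^s} on the torus 𝕋^d, expressed on the Fourier-coefficient side.) -/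

import Mathlib

open scoped ComplexInnerProductSpace
open Finset

noncomputable section

/-- The cube of lattice points `k ∈ ℤ^d` with sup norm `|k|∞ ≤ K`. -/
def cube (d K : ℕ) : Finset (Fin d → ℤ) :=
  Fintype.piFinset fun _ => Finset.Icc (-(K : ℤ)) (K : ℤ)

/-- The Sobolev weight `(1 + |k|₂²)^s`. -/
def weight (d : ℕ) (s : ℝ) (k : Fin d → ℤ) : ℝ :=
  (1 + ∑ i, ((k i : ℝ)) ^ 2) ^ s

variable {H : Type*} [NormedAddCommGroup H] [InnerProductSpace ℂ H] [CompleteSpace H]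

/-- The estimator `T = ∑_{|k|∞ ≤ K} w_k ⊗ e_k`, i.e. `T u = ∑_{|k|∞ ≤ K} ⟨u, e_k⟩ w_k`
(with the Mathlib convention that `⟪·,·⟫` is linear in the second argument, so the paper
inner product `⟨u, e_k⟩` is `⟪e k, u⟫`). -/
def estimator {d : ℕ} (e : HilbertBasis (Fin d → ℤ) ℂ H)
    (w : (Fin d → ℤ) → H) (K : ℕ) : H →L[ℂ] H :=
  ∑ k ∈ cube d K, (innerSL ℂ (e k)).smulRight (w k)

/-- The Sobolev norm `‖ψ‖_{H^s}`. -/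
def sobolevNorm {d : ℕ} (s : ℝ) (e : HilbertBasis (Fin d → ℤ) ℂ H) (ψ : H) : ℝ :=
  Real.sqrt (∑' k, weight d s k * ‖⟪e k, ψ⟫‖ ^ 2)

/-- Membership in the Sobolev space `H^s`. -/
def memSobolev {d : ℕ} (s : ℝ) (e : HilbertBasis (Fin d → ℤ) ℂ H) (ψ : H) : Prop :=
  Summable fun k => weight d s k * ‖⟪e k, ψ⟫‖ ^ 2

/-- `γ_K = (∑_{|k|∞ ≤ K} (1+|k|₂²)^{-s})^{1/2}`. -/
def gammaK (d : ℕ) (s : ℝ) (K : ℕ) : ℝ :=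
  Real.sqrt (∑ k ∈ cube d K, (weight d s k)⁻¹)

theorem weight_eq_rpow (d : ℕ) (s : ℝ) (k : Fin d → ℤ) :
    weight d s k = weight d 1 k ^ s := by simp [weight]

theorem weight_pos (d : ℕ) (s : ℝ) (k : Fin d → ℤ) : 0 < weight d s k :=
  Real.rpow_pos_of_pos
    (add_pos_of_pos_of_nonneg one_pos (Finset.sum_nonneg fun i _ => sq_nonneg (k i : ℝ))) s

theorem weight_one_add_le (d : ℕ) (k l : Fin d → ℤ) :
    weight d 1 (k + l) ≤ 2 * (weight d 1 k + weight d 1 l) := by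
  simp only [weight, Real.rpow_one, Pi.add_apply, Int.cast_add]
  have h : ∑ i, ((k i : ℝ) + l i) ^ 2 ≤ ∑ i, 2 * ((k i : ℝ) ^ 2 + (l i : ℝ) ^ 2) :=
    Finset.sum_le_sum fun i _ => by nlinarith [sq_nonneg ((k i : ℝ) - l i)]
  rw [← Finset.mul_sum, Finset.sum_add_distrib] at h
  linarith

theorem rpow_le_four_rpow_mul_rpow {x y z s : ℝ} (hx : 0 ≤ x)
    (hxyz : x ≤ 2 * (y + z)) (hs : 0 ≤ s) (hyz : z ≤ y) (hy : 0 ≤ y) :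
    x ^ s ≤ 4 ^ s * y ^ s := by
  rw [← Real.mul_rpow (by norm_num) hy]
  exact Real.rpow_le_rpow hx (by linarith) hs

/-- Pointwise bound behind the Peetre-type estimate for convolution weights. -/
theorem weight_ratio_le {d : ℕ} {s r : ℝ} (hs : 0 ≤ s) (hsr : s ≤ r) (k l : Fin d → ℤ) :
    weight d s (k + l) * ((weight d r k)⁻¹ * (weight d s l)⁻¹) ≤
      4 ^ s * ((weight d r k)⁻¹ + (weight d r l)⁻¹) := by
  have hx := weight_pos d 1 (k + l)
  have hy := weight_pos d 1 k
  have hz := weight_pos d 1 l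
  have hxyz := weight_one_add_le d k l
  rw [weight_eq_rpow d s (k + l), weight_eq_rpow d r k, weight_eq_rpow d s l,
    weight_eq_rpow d r l]
  generalize weight d 1 (k + l) = x at *
  generalize weight d 1 k = y at *
  generalize weight d 1 l = z at *
  rw [mul_add]
  rcases le_total z y with h | h
  · have hxs := rpow_le_four_rpow_mul_rpow hx.le hxyz hs h hy.le
    have hmono : z ^ (r - s) ≤ y ^ (r - s) := Real.rpow_le_rpow hz.le h (by linarith)
    have hyr : y ^ r = y ^ (r - s) * y ^ s := by rw [← Real.rpow_add hy]; ring_nf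
    have hzr : z ^ r = z ^ (r - s) * z ^ s := by rw [← Real.rpow_add hz]; ring_nf
    calc x ^ s * ((y ^ r)⁻¹ * (z ^ s)⁻¹) ≤ 4 ^ s * y ^ s * ((y ^ r)⁻¹ * (z ^ s)⁻¹) := by gcongr
      _ = 4 ^ s * ((y ^ (r - s))⁻¹ * (z ^ s)⁻¹) := by
        rw [hyr]; field_simp
      _ ≤ 4 ^ s * ((z ^ (r - s))⁻¹ * (z ^ s)⁻¹) := by gcongr
      _ = 4 ^ s * (z ^ r)⁻¹ := by rw [hzr, mul_inv]
      _ ≤ _ := le_add_of_nonneg_left (by positivity)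
  · have hxs := rpow_le_four_rpow_mul_rpow hx.le (by linarith : x ≤ 2 * (z + y)) hs h hz.le
    calc x ^ s * ((y ^ r)⁻¹ * (z ^ s)⁻¹) ≤ 4 ^ s * z ^ s * ((y ^ r)⁻¹ * (z ^ s)⁻¹) := by gcongr
      _ = 4 ^ s * (y ^ r)⁻¹ := by field_simp
      _ ≤ _ := le_add_of_nonneg_right (by positivity)

theorem summable_norm_rpow_comp_of_injective {α E : Type*} [NormedAddCommGroup E]
    [NormedSpace ℝ E] [FiniteDimensional ℝ E] (L : Submodule ℤ E) [DiscreteTopology L]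
    [IsZLattice ℝ L] {f : α → E} (hf : Function.Injective f) (hL : ∀ x, f x ∈ L) {p : ℝ}
    (hp : p < -(Module.finrank ℝ E : ℝ)) : Summable fun x => ‖f x‖ ^ p :=
  (ZLattice.summable_norm_rpow L p (by rwa [ZLattice.rank ℝ L])).comp_injective
    (i := fun x => (⟨f x, hL x⟩ : L)) fun _ _ h => hf (congrArg Subtype.val h)

theorem summable_int_pi_norm_rpow {ι : Type*} [Fintype ι] {p : ℝ}
    (hp : p < -(Fintype.card ι : ℝ)) :
    Summable fun k : ι → ℤ => ‖fun i => (k i : ℝ)‖ ^ p :=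
  summable_norm_rpow_comp_of_injective (Submodule.span ℤ (Set.range (Pi.basisFun ℝ ι)))
    (fun _ _ h => funext fun i => Int.cast_injective (congrFun h i))
    (fun k => ((Pi.basisFun ℝ ι).mem_span_iff_repr_mem ℤ _).2 fun i => ⟨k i, by simp⟩)
    (by rwa [Module.finrank_fintype_fun_eq_card])

theorem summable_weight_inv {d : ℕ} {r : ℝ} (hr : (d : ℝ) < 2 * r) :
    Summable fun k => (weight d r k)⁻¹ := by
  have hr0 : 0 < r := by have := d.cast_nonneg (α := ℝ); linarith
  refine Summable.of_norm_bounded_eventually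
    (summable_int_pi_norm_rpow (ι := Fin d) (p := -(2 * r)) (by simpa using hr)) ?_
  filter_upwards [(Set.finite_singleton (0 : Fin d → ℤ)).compl_mem_cofinite] with k hk
  have hn : 0 < ‖fun i => (k i : ℝ)‖ := norm_pos_iff.2 fun h => hk <| funext fun i =>
    Int.cast_eq_zero.1 (congrFun h i)
  have hsq : ‖fun i => (k i : ℝ)‖ ^ 2 ≤ 1 + ∑ i, (k i : ℝ) ^ 2 := by
    have hnn : 0 ≤ 1 + ∑ i, (k i : ℝ) ^ 2 := by positivity
    refine (Real.le_sqrt hn.le hnn).1 ((pi_norm_le_iff_of_nonneg (Real.sqrt_nonneg _)).2 fun i => ?_)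
    refine Real.abs_le_sqrt ?_
    have := Finset.single_le_sum (f := fun i => (k i : ℝ) ^ 2)
      (fun i _ => sq_nonneg _) (Finset.mem_univ i)
    linarith
  rw [Real.norm_of_nonneg (inv_nonneg.2 (weight_pos d r k).le), Real.rpow_neg hn.le,
    Real.rpow_mul hn.le, Real.rpow_two]
  gcongr
  exact Real.rpow_le_rpow (by positivity) hsq hr0.le

theorem sq_tsum_mul_le {ι : Type*} {f g : ι → ℝ} (hf : ∀ i, 0 ≤ f i) (hg : ∀ i, 0 ≤ g i)
    (hf2 : Summable fun i => f i ^ 2) (hg2 : Summable fun i => g i ^ 2) :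
    (Summable fun i => f i * g i) ∧
      (∑' i, f i * g i) ^ 2 ≤ (∑' i, f i ^ 2) * ∑' i, g i ^ 2 := by
  obtain ⟨hfg, hle⟩ := Real.summable_and_inner_le_Lp_mul_Lq_tsum_of_nonneg Real.HolderConjugate.two_two hf hg
    (by simpa using hf2) (by simpa using hg2)
  refine ⟨hfg, ?_⟩
  have hF : 0 ≤ ∑' i, f i ^ 2 := tsum_nonneg fun i => sq_nonneg _
  have hG : 0 ≤ ∑' i, g i ^ 2 := tsum_nonneg fun i => sq_nonneg _
  simp only [Real.rpow_two, ← Real.sqrt_eq_rpow, ← Real.sqrt_mul hF] at hle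
  exact (Real.le_sqrt (tsum_nonneg fun i => mul_nonneg (hf i) (hg i)) (mul_nonneg hF hG)).1 hle

/-- Convolution of two nonnegative summable families on an additive commutative group. -/
theorem hasSum_tsum_mul_sub {G : Type*} [AddCommGroup G] {A B : G → ℝ}
    (hA0 : ∀ k, 0 ≤ A k) (hB0 : ∀ k, 0 ≤ B k) (hA : Summable A) (hB : Summable B) :
    (∀ k, Summable fun l => A l * B (k - l)) ∧
      HasSum (fun k => ∑' l, A l * B (k - l)) ((∑' k, A k) * ∑' k, B k) := by
  let e : G × G ≃ G × G :=
    { toFun := fun p => (p.2, p.1 - p.2)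
      invFun := fun q => (q.1 + q.2, q.1)
      left_inv := fun p => by simp
      right_inv := fun q => by simp }
  have hAB : Summable fun q : G × G => A q.1 * B q.2 := hA.mul_of_nonneg hB hA0 hB0
  have hsum : HasSum (fun p : G × G => A p.2 * B (p.1 - p.2)) ((∑' k, A k) * ∑' k, B k) :=
    e.hasSum_iff.2 (hA.hasSum.mul hB.hasSum hAB)
  exact ⟨hsum.summable.prod_factor, hsum.prod_fiberwise fun k =>
    (hsum.summable.prod_factor k).hasSum⟩

/-- Sobolev multiplication inequality on the Fourier side:
`‖a * b‖_{H^s} ≤ C ‖a‖_{H^r} ‖b‖_{H^s}` for `0 ≤ s ≤ r`, `2r > d`, where `*` is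
convolution on `ℤ^d`. -/
theorem sobolev_multiplication {d : ℕ} (hd : 1 ≤ d) {s r : ℝ}
    (hs0 : 0 ≤ s) (hsr : s ≤ r) (hr : (d : ℝ) < 2 * r) :
    ∃ C : ℝ, ∀ a b : (Fin d → ℤ) → ℂ,
      Summable (fun k => weight d r k * ‖a k‖ ^ 2) →
      Summable (fun k => weight d s k * ‖b k‖ ^ 2) →
      (∀ k, Summable fun l => ‖a l * b (k - l)‖) ∧
      ∑' k, weight d s k * ‖∑' l, a l * b (k - l)‖ ^ 2
        ≤ C * (∑' k, weight d r k * ‖a k‖ ^ 2)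
            * (∑' k, weight d s k * ‖b k‖ ^ 2) := by
  have hW : Summable fun k => (weight d r k)⁻¹ := summable_weight_inv hr
  set S := ∑' k, (weight d r k)⁻¹
  refine ⟨4 ^ s * (S + S), fun a b ha hb => ?_⟩
  obtain ⟨hconv, hconv_sum⟩ := hasSum_tsum_mul_sub
    (fun k => mul_nonneg (weight_pos d r k).le (sq_nonneg ‖a k‖))
    (fun k => mul_nonneg (weight_pos d s k).le (sq_nonneg ‖b k‖)) ha hb
  have hWk : ∀ k, Summable fun l => (weight d r (k - l))⁻¹ := fun k =>
    (Equiv.subLeft k).summable_iff.2 hW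
  have hratio : ∀ k l, weight d s k * ((weight d r l)⁻¹ * (weight d s (k - l))⁻¹) ≤
      4 ^ s * ((weight d r l)⁻¹ + (weight d r (k - l))⁻¹) := fun k l => by
    simpa using weight_ratio_le hs0 hsr l (k - l)
  have hQ : ∀ k, Summable fun l => weight d s k * ((weight d r l)⁻¹ * (weight d s (k - l))⁻¹) :=
    fun k => Summable.of_nonneg_of_le
      (fun l => by
        have := weight_pos d s k
        have := weight_pos d r l
        have := weight_pos d s (k - l)
        positivity)
      (hratio k) ((hW.add (hWk k)).mul_left _)
  have hQle : ∀ k, ∑' l, weight d s k * ((weight d r l)⁻¹ * (weight d s (k - l))⁻¹) ≤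
      4 ^ s * (S + S) := fun k => by
    refine ((hQ k).tsum_le_tsum (hratio k) ((hW.add (hWk k)).mul_left _)).trans_eq ?_
    rw [tsum_mul_left, hW.tsum_add (hWk k),
      show ∑' l, (weight d r (k - l))⁻¹ = S from
        (Equiv.subLeft k).tsum_eq fun l => (weight d r l)⁻¹]
  have key : ∀ k, (Summable fun l => ‖a l * b (k - l)‖) ∧
      weight d s k * ‖∑' l, a l * b (k - l)‖ ^ 2 ≤ 4 ^ s * (S + S) *
        ∑' l, weight d r l * ‖a l‖ ^ 2 * (weight d s (k - l) * ‖b (k - l)‖ ^ 2) := fun k => by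
    have hk := weight_pos d s k
    have hf2 : ∀ l, √((weight d r l)⁻¹ * (weight d s (k - l))⁻¹) ^ 2 =
        (weight d r l)⁻¹ * (weight d s (k - l))⁻¹ := fun l =>
      Real.sq_sqrt (mul_pos (inv_pos.2 (weight_pos d r l)) (inv_pos.2 (weight_pos d s _))).le
    have hg2 : ∀ l, √(weight d r l * ‖a l‖ ^ 2 * (weight d s (k - l) * ‖b (k - l)‖ ^ 2)) ^ 2 =
        weight d r l * ‖a l‖ ^ 2 * (weight d s (k - l) * ‖b (k - l)‖ ^ 2) := fun l =>
      Real.sq_sqrt (mul_nonneg (mul_nonneg (weight_pos d r l).le (sq_nonneg _))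
        (mul_nonneg (weight_pos d s _).le (sq_nonneg _)))
    have hfg : ∀ l, √((weight d r l)⁻¹ * (weight d s (k - l))⁻¹) *
        √(weight d r l * ‖a l‖ ^ 2 * (weight d s (k - l) * ‖b (k - l)‖ ^ 2)) =
        ‖a l * b (k - l)‖ := fun l => by
      have h1 := weight_pos d r l
      have h2 := weight_pos d s (k - l)
      rw [← Real.sqrt_mul (by positivity), norm_mul, Real.sqrt_eq_iff_mul_self_eq (by positivity)
        (by positivity)]
      field_simp
    have hcs := sq_tsum_mul_le (fun l => Real.sqrt_nonneg _) (fun l => Real.sqrt_nonneg _)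
      ((summable_mul_left_iff hk.ne').1 (hQ k) |>.congr fun l => (hf2 l).symm)
      ((hconv k).congr fun l => (hg2 l).symm)
    simp only [hf2, hg2, hfg] at hcs
    refine ⟨hcs.1, ?_⟩
    calc weight d s k * ‖∑' l, a l * b (k - l)‖ ^ 2
        ≤ weight d s k * (∑' l, ‖a l * b (k - l)‖) ^ 2 := by
          gcongr
          exact norm_tsum_le_tsum_norm hcs.1
      _ ≤ weight d s k * _ := mul_le_mul_of_nonneg_left hcs.2 hk.le
      _ = (∑' l, weight d s k * ((weight d r l)⁻¹ * (weight d s (k - l))⁻¹)) * _ := by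
          rw [tsum_mul_left, mul_assoc]
      _ ≤ _ := mul_le_mul_of_nonneg_right (hQle k) (tsum_nonneg fun l => hg2 l ▸ sq_nonneg _)
  refine ⟨fun k => (key k).1, ?_⟩
  have hbound := hconv_sum.mul_left (4 ^ s * (S + S))
  have hsummable := Summable.of_nonneg_of_le
    (fun k => mul_nonneg (weight_pos d s k).le (sq_nonneg _)) (fun k => (key k).2) hbound.summable
  rw [mul_assoc, ← hbound.tsum_eq]
  exact hsummable.tsum_le_tsum (fun k => (key k).2) hbound.summable
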